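/- (No cycles / convergence to equilibrium.) Consider the planar system λ' = Φ(λ,α) := -ω(λ - λ_b) + r(α)G(λ), α' = Ψ(λ,α) := θα_b - α·h(λ), with ω, θ > 0, α_b ≥ 0, λ_b ≥ 0, G(z)=z(z₀-z), r(z)=1/(1+e^{-β(z-a)}), h(z)=θ/(1+z)^p, 0<p≤1. If α(0) ≥ 0 and 0 ≤ λ(0) ≤ z₀, then this system has no nonconstant periodic orbits in the region {λ ≥ 0, α ≥ 0}, and every bounded forward trajectory converges to a stationary point. -/

import Mathlib

open Real Filter Set

noncomputable def rfun (β a z : ℝ) : ℝ := 1 / (1 + Real.exp (-β * (z - a)))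

noncomputable def hfun (θ p z : ℝ) : ℝ := θ / (1 + z) ^ p

noncomputable def Gfun (z₀ z : ℝ) : ℝ := z * (z₀ - z)

noncomputable def Phi (ω lamb z₀ β a : ℝ) (l A : ℝ) : ℝ :=
  -ω * (l - lamb) + rfun β a A * Gfun z₀ l

noncomputable def Psi (θ αb p : ℝ) (l A : ℝ) : ℝ :=
  θ * αb - A * hfun θ p l

theorem hasDerivAt_max_zero_sq (x : ℝ) :
    HasDerivAt (fun y : ℝ => (max y 0) ^ 2) (2 * max x 0) x := by
  rcases lt_trichotomy x 0 with h | h | h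
  · have : (fun y : ℝ => (max y 0) ^ 2) =ᶠ[nhds x] fun _ => 0 := by
      filter_upwards [Iio_mem_nhds h] with y hy
      simp [max_eq_right (le_of_lt (mem_Iio.1 hy))]
    rw [max_eq_right h.le, mul_zero]
    exact (hasDerivAt_const x (0 : ℝ)).congr_of_eventuallyEq this
  · subst h
    rw [max_self, mul_zero]
    refine HasDerivAt.of_isLittleO ?_
    have h2 : (fun y : ℝ => (max y 0) ^ 2) =O[nhds 0] fun y : ℝ => y ^ 2 := by
      refine Asymptotics.IsBigO.of_bound 1 (Eventually.of_forall fun y => ?_)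
      rw [one_mul, norm_of_nonneg (sq_nonneg _), norm_of_nonneg (sq_nonneg _)]
      rcases le_total y 0 with hy | hy
      · simp [hy, sq_nonneg]
      · simp [hy]
    have h3 : (fun y : ℝ => y ^ 2) =o[nhds 0] fun y : ℝ => y :=
      Asymptotics.isLittleO_pow_id one_lt_two
    simpa using h2.trans_isLittleO h3
  · have : (fun y : ℝ => (max y 0) ^ 2) =ᶠ[nhds x] fun y => y ^ 2 := by
      filter_upwards [Ioi_mem_nhds h] with y hy
      rw [max_eq_left (le_of_lt (mem_Ioi.1 hy))]
    rw [max_eq_left h.le]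
    simpa using (hasDerivAt_pow 2 x).congr_of_eventuallyEq this

theorem antitoneOn_Icc_of_hasDerivAt_nonpos {f f' : ℝ → ℝ} {s t : ℝ}
    (hf : ∀ x ∈ Icc s t, HasDerivAt f (f' x) x) (hf' : ∀ x ∈ Icc s t, f' x ≤ 0) :
    AntitoneOn f (Icc s t) := by
  refine antitoneOn_of_hasDerivWithinAt_nonpos (f' := f') (convex_Icc s t)
    (fun x hx => (hf x hx).continuousAt.continuousWithinAt) (fun x hx => ?_) (fun x hx => ?_)
  · exact (hf x (interior_subset hx)).hasDerivWithinAt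
  · exact hf' x (interior_subset hx)

theorem antitoneOn_Ici_of_hasDerivAt_nonpos {f f' : ℝ → ℝ} {s : ℝ}
    (hf : ∀ x, s ≤ x → HasDerivAt f (f' x) x) (hf' : ∀ x, s ≤ x → f' x ≤ 0) :
    AntitoneOn f (Ici s) := fun _ hx y _ hxy =>
  antitoneOn_Icc_of_hasDerivAt_nonpos (s := s) (t := y) (fun z hz => hf z hz.1)
    (fun z hz => hf' z hz.1) ⟨hx, hxy⟩ ⟨le_trans hx hxy, le_rfl⟩ hxy

theorem le_of_hasDerivAt_nonpos_above {f f' : ℝ → ℝ} {s c : ℝ}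
    (hf : ∀ t, s ≤ t → HasDerivAt f (f' t) t) (hf' : ∀ t, s ≤ t → c < f t → f' t ≤ 0)
    (h0 : f s ≤ c) : ∀ t, s ≤ t → f t ≤ c := by
  have hanti : AntitoneOn (fun t => (max (f t - c) 0) ^ 2) (Ici s) := by
    refine antitoneOn_Ici_of_hasDerivAt_nonpos (f' := fun t => 2 * max (f t - c) 0 * f' t)
      (fun t ht => ?_) (fun t ht => ?_)
    · exact (hasDerivAt_max_zero_sq (f t - c)).comp t ((hf t ht).sub_const c)
    · rcases le_or_gt (f t) c with h | h
      · simp [max_eq_right (sub_nonpos.2 h)]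
      · exact mul_nonpos_of_nonneg_of_nonpos (by positivity) (hf' t ht h)
  intro t ht
  have h := hanti (mem_Ici.2 le_rfl) (mem_Ici.2 ht) ht
  simp only [max_eq_right (sub_nonpos.2 h0)] at h
  have h2 : max (f t - c) 0 = 0 := by
    have := sq_nonneg (max (f t - c) 0)
    exact pow_eq_zero_iff two_ne_zero |>.1 (by linarith)
  linarith [le_max_left (f t - c) 0]

theorem eventually_ge_of_hasDerivAt_pos_below {f f' : ℝ → ℝ} {s l c : ℝ} (hc : 0 < c)
    (hf : ∀ t, s ≤ t → HasDerivAt f (f' t) t) (hf' : ∀ t, s ≤ t → f t ≤ l → c ≤ f' t) :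
    ∃ t₀, s ≤ t₀ ∧ ∀ t, t₀ ≤ t → l ≤ f t := by
  obtain ⟨t₀, hst, ht₀⟩ : ∃ t₀, s ≤ t₀ ∧ l ≤ f t₀ := by
    by_contra! hcon
    have hanti : AntitoneOn (fun t => c * t - f t) (Ici s) := by
      refine antitoneOn_Ici_of_hasDerivAt_nonpos (f' := fun t => c - f' t)
        (fun t ht => ?_) (fun t ht => sub_nonpos.2 (hf' t ht (hcon t ht).le))
      simpa using ((hasDerivAt_id t).const_mul c).fun_sub (hf t ht)
    have hpos : 0 ≤ (l - f s) / c := div_nonneg (sub_nonneg.2 (hcon s le_rfl).le) hc.le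
    have hst : s ≤ s + (l - f s) / c := by linarith
    have h := hanti (mem_Ici.2 le_rfl) (mem_Ici.2 hst) hst
    have hmul : c * ((l - f s) / c) = l - f s := by field_simp
    simp only [mul_add, hmul] at h
    linarith [hcon _ hst]
  refine ⟨t₀, hst, fun t ht => ?_⟩
  have := le_of_hasDerivAt_nonpos_above (f := fun t => -f t) (f' := fun t => -f' t) (s := t₀)
    (c := -l) (fun t ht => (hf t (hst.trans ht)).neg)
    (fun t ht h => by linarith [hf' t (hst.trans ht) (by linarith)]) (by linarith) t ht
  linarith

theorem eq_zero_of_tendsto_of_tendsto_deriv {f f' : ℝ → ℝ} {s l L : ℝ}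
    (hf : ∀ t, s ≤ t → HasDerivAt f (f' t) t) (hl : Tendsto f atTop (nhds l))
    (hL : Tendsto f' atTop (nhds L)) : L = 0 := by
  have hmv : ∀ t, ∃ ξ, t ≤ ξ ∧ (s ≤ t → f' ξ = f (t + 1) - f t) := by
    intro t
    by_cases ht : s ≤ t
    · obtain ⟨ξ, hξ, h⟩ := exists_hasDerivAt_eq_slope f f' (lt_add_one t)
        (fun x hx => (hf x (ht.trans hx.1)).continuousAt.continuousWithinAt)
        (fun x hx => hf x (ht.trans hx.1.le))
      exact ⟨ξ, hξ.1.le, fun _ => by simpa using h⟩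
    · exact ⟨t, le_rfl, fun h => absurd h ht⟩
  choose ξ hξ h using hmv
  have h1 : Tendsto (fun t => f' (ξ t)) atTop (nhds L) :=
    hL.comp (tendsto_atTop_mono hξ tendsto_id)
  have h2 : Tendsto (fun t => f (t + 1) - f t) atTop (nhds (l - l)) :=
    (hl.comp (tendsto_atTop_add_const_right _ 1 tendsto_id)).sub hl
  rw [sub_self] at h2
  refine tendsto_nhds_unique h1 (h2.congr' ?_)
  filter_upwards [eventually_ge_atTop s] with t ht using (h t ht).symm

theorem exists_tendsto_of_hasDerivAt_nonpos {f f' : ℝ → ℝ} {s M : ℝ}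
    (hf : ∀ t, s ≤ t → HasDerivAt f (f' t) t) (hf' : ∀ t, s ≤ t → f' t ≤ 0)
    (hM : ∀ t, s ≤ t → |f t| ≤ M) : ∃ l, Tendsto f atTop (nhds l) := by
  have hanti := antitoneOn_Ici_of_hasDerivAt_nonpos hf hf'
  have hg : Antitone fun t => f (max t s) := fun x y hxy =>
    hanti (mem_Ici.2 (le_max_right _ _)) (mem_Ici.2 (le_max_right _ _)) (max_le_max hxy le_rfl)
  refine ⟨_, (tendsto_atTop_ciInf hg ⟨-M, ?_⟩).congr' ?_⟩
  · rintro _ ⟨t, rfl⟩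
    exact (abs_le.1 (hM _ (le_max_right _ _))).1
  · filter_upwards [eventually_ge_atTop s] with t ht
    rw [max_eq_left ht]

theorem exists_tendsto_of_hasDerivAt_nonneg {f f' : ℝ → ℝ} {s M : ℝ}
    (hf : ∀ t, s ≤ t → HasDerivAt f (f' t) t) (hf' : ∀ t, s ≤ t → 0 ≤ f' t)
    (hM : ∀ t, s ≤ t → |f t| ≤ M) : ∃ l, Tendsto f atTop (nhds l) := by
  obtain ⟨l, hl⟩ := exists_tendsto_of_hasDerivAt_nonpos (f := fun t => -f t)
    (f' := fun t => -f' t) (fun t ht => (hf t ht).neg)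
    (fun t ht => neg_nonpos.2 (hf' t ht)) (fun t ht => by rw [abs_neg]; exact hM t ht)
  exact ⟨-l, by simpa using hl.neg⟩

/-- The closed negative quadrant is forward invariant for a linear cooperative planar system. -/
theorem nonpos_of_cooperative {u v a b c d : ℝ → ℝ} {s : ℝ}
    (ha : ContinuousOn a (Ici s)) (hb : ContinuousOn b (Ici s))
    (hc : ContinuousOn c (Ici s)) (hd : ContinuousOn d (Ici s))
    (hb0 : ∀ t, s ≤ t → 0 ≤ b t) (hc0 : ∀ t, s ≤ t → 0 ≤ c t)
    (hu : ∀ t, s ≤ t → HasDerivAt u (a t * u t + b t * v t) t)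
    (hv : ∀ t, s ≤ t → HasDerivAt v (c t * u t + d t * v t) t)
    (hus : u s ≤ 0) (hvs : v s ≤ 0) : ∀ t, s ≤ t → u t ≤ 0 ∧ v t ≤ 0 := by
  intro T hT
  have hbound : ∀ g : ℝ → ℝ, ContinuousOn g (Ici s) → ∃ C, ∀ t ∈ Icc s T, |g t| ≤ C :=
    fun g hg => isCompact_Icc.exists_bound_of_continuousOn (hg.mono fun _ h => h.1)
  obtain ⟨Ka, hKa⟩ := hbound a ha
  obtain ⟨Kb, hKb⟩ := hbound b hb
  obtain ⟨Kc, hKc⟩ := hbound c hc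
  obtain ⟨Kd, hKd⟩ := hbound d hd
  set K := 2 * (|Ka| + |Kb| + |Kc| + |Kd|) with hK
  set W : ℝ → ℝ := fun t => (max (u t) 0) ^ 2 + (max (v t) 0) ^ 2 with hW
  set W' : ℝ → ℝ := fun t => 2 * max (u t) 0 * (a t * u t + b t * v t)
    + 2 * max (v t) 0 * (c t * u t + d t * v t) with hW'
  have hWd : ∀ t, s ≤ t → HasDerivAt W (W' t) t := fun t ht =>
    ((hasDerivAt_max_zero_sq (u t)).comp t (hu t ht)).add
      ((hasDerivAt_max_zero_sq (v t)).comp t (hv t ht))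
  have hWle : ∀ t ∈ Icc s T, W' t ≤ K * W t := by
    intro t ht
    have hx0 : 0 ≤ max (u t) 0 := le_max_right _ _
    have hy0 : 0 ≤ max (v t) 0 := le_max_right _ _
    have hxx : max (u t) 0 * u t = max (u t) 0 ^ 2 := by
      rcases le_total (u t) 0 with h | h <;> simp [h, sq]
    have hyy : max (v t) 0 * v t = max (v t) 0 ^ 2 := by
      rcases le_total (v t) 0 with h | h <;> simp [h, sq]
    have hxv : max (u t) 0 * v t ≤ max (u t) 0 * max (v t) 0 :=
      mul_le_mul_of_nonneg_left (le_max_left _ _) hx0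
    have hyu : max (v t) 0 * u t ≤ max (u t) 0 * max (v t) 0 := by
      rw [mul_comm (max (u t) 0)]
      exact mul_le_mul_of_nonneg_left (le_max_left _ _) hy0
    have ea : a t ≤ |Ka| := (le_abs_self _).trans ((hKa t ht).trans (le_abs_self _))
    have eb : b t ≤ |Kb| := (le_abs_self _).trans ((hKb t ht).trans (le_abs_self _))
    have ec : c t ≤ |Kc| := (le_abs_self _).trans ((hKc t ht).trans (le_abs_self _))
    have ed : d t ≤ |Kd| := (le_abs_self _).trans ((hKd t ht).trans (le_abs_self _))
    have e1 : a t * (max (u t) 0 * u t) ≤ |Ka| * max (u t) 0 ^ 2 := by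
      rw [hxx]; gcongr
    have e2 : b t * (max (u t) 0 * v t) ≤ |Kb| * (max (u t) 0 * max (v t) 0) :=
      (mul_le_mul_of_nonneg_left hxv (hb0 t ht.1)).trans (by gcongr)
    have e3 : c t * (max (v t) 0 * u t) ≤ |Kc| * (max (u t) 0 * max (v t) 0) :=
      (mul_le_mul_of_nonneg_left hyu (hc0 t ht.1)).trans (by gcongr)
    have e4 : d t * (max (v t) 0 * v t) ≤ |Kd| * max (v t) 0 ^ 2 := by
      rw [hyy]; gcongr
    have hxy : max (u t) 0 * max (v t) 0 ≤ max (u t) 0 ^ 2 + max (v t) 0 ^ 2 := by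
      nlinarith [sq_nonneg (max (u t) 0 - max (v t) 0), sq_nonneg (max (u t) 0),
        sq_nonneg (max (v t) 0)]
    have e5 := mul_le_mul_of_nonneg_left hxy (abs_nonneg Kb)
    have e6 := mul_le_mul_of_nonneg_left hxy (abs_nonneg Kc)
    have e7 := mul_nonneg (abs_nonneg Ka) (sq_nonneg (max (v t) 0))
    have e8 := mul_nonneg (abs_nonneg Kd) (sq_nonneg (max (u t) 0))
    simp only [hW, hW', hK]
    linarith
  have hanti : AntitoneOn (fun t => W t * exp (-K * t)) (Icc s T) := by
    refine antitoneOn_Icc_of_hasDerivAt_nonpos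
      (f' := fun t => W' t * exp (-K * t) + W t * (exp (-K * t) * -K))
      (fun t ht => ?_) (fun t ht => ?_)
    · have hlin : HasDerivAt (fun t => -K * t) (-K) t := by
        simpa using (hasDerivAt_id t).const_mul (-K)
      exact (hWd t ht.1).mul hlin.exp
    · have := mul_nonneg (sub_nonneg.2 (hWle t ht)) (exp_pos (-K * t)).le
      linarith
  have h := hanti (left_mem_Icc.2 hT) (right_mem_Icc.2 hT) hT
  have hWs : W s = 0 := by simp [hW, hus, hvs]
  simp only [hWs, zero_mul] at h
  have hWT : W T ≤ 0 := nonpos_of_mul_nonpos_left h (exp_pos _)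
  simp only [hW] at hWT
  have hu2 : max (u T) 0 = 0 := pow_eq_zero_iff two_ne_zero |>.1
    (le_antisymm (by linarith [sq_nonneg (max (v T) 0)]) (sq_nonneg _))
  have hv2 : max (v T) 0 = 0 := pow_eq_zero_iff two_ne_zero |>.1
    (le_antisymm (by linarith [sq_nonneg (max (u T) 0)]) (sq_nonneg _))
  exact ⟨max_eq_right_iff.1 hu2, max_eq_right_iff.1 hv2⟩

/-- Each component of a solution of a linear cooperative planar system eventually keeps its
sign. -/
theorem eventually_sign_of_cooperative {u v a b c d : ℝ → ℝ} {s : ℝ}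
    (ha : ContinuousOn a (Ici s)) (hb : ContinuousOn b (Ici s))
    (hc : ContinuousOn c (Ici s)) (hd : ContinuousOn d (Ici s))
    (hb0 : ∀ t, s ≤ t → 0 ≤ b t) (hc0 : ∀ t, s ≤ t → 0 ≤ c t)
    (hu : ∀ t, s ≤ t → HasDerivAt u (a t * u t + b t * v t) t)
    (hv : ∀ t, s ≤ t → HasDerivAt v (c t * u t + d t * v t) t) :
    ∃ t₀, s ≤ t₀ ∧ ((∀ t, t₀ ≤ t → u t ≤ 0) ∨ (∀ t, t₀ ≤ t → 0 ≤ u t)) ∧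
      ((∀ t, t₀ ≤ t → v t ≤ 0) ∨ (∀ t, t₀ ≤ t → 0 ≤ v t)) := by
  by_cases hneg : ∃ t₀, s ≤ t₀ ∧ u t₀ ≤ 0 ∧ v t₀ ≤ 0
  · obtain ⟨t₀, hs, hu0, hv0⟩ := hneg
    have hsub : Ici t₀ ⊆ Ici s := Ici_subset_Ici.2 hs
    have h := nonpos_of_cooperative (ha.mono hsub) (hb.mono hsub) (hc.mono hsub) (hd.mono hsub)
      (fun t ht => hb0 t (hs.trans ht)) (fun t ht => hc0 t (hs.trans ht))
      (fun t ht => hu t (hs.trans ht)) (fun t ht => hv t (hs.trans ht)) hu0 hv0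
    exact ⟨t₀, hs, .inl fun t ht => (h t ht).1, .inl fun t ht => (h t ht).2⟩
  by_cases hpos : ∃ t₀, s ≤ t₀ ∧ 0 ≤ u t₀ ∧ 0 ≤ v t₀
  · obtain ⟨t₀, hs, hu0, hv0⟩ := hpos
    have hsub : Ici t₀ ⊆ Ici s := Ici_subset_Ici.2 hs
    have h := nonpos_of_cooperative (u := fun t => -u t) (v := fun t => -v t)
      (ha.mono hsub) (hb.mono hsub) (hc.mono hsub) (hd.mono hsub)
      (fun t ht => hb0 t (hs.trans ht)) (fun t ht => hc0 t (hs.trans ht))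
      (fun t ht => (hu t (hs.trans ht)).fun_neg.congr_deriv (by ring))
      (fun t ht => (hv t (hs.trans ht)).fun_neg.congr_deriv (by ring))
      (neg_nonpos.2 hu0) (neg_nonpos.2 hv0)
    exact ⟨t₀, hs, .inr fun t ht => neg_nonpos.1 (h t ht).1,
      .inr fun t ht => neg_nonpos.1 (h t ht).2⟩
  push Not at hneg hpos
  have hu0 : ∀ t, s ≤ t → u t ≠ 0 := fun t ht h =>
    lt_asymm (hneg t ht h.le) (hpos t ht h.ge)
  have hcont : ContinuousOn u (Ici s) := fun t ht => (hu t ht).continuousAt.continuousWithinAt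
  have hconst : ∀ t, s ≤ t → ∀ t', s ≤ t' → u t < 0 → u t' < 0 := by
    intro t ht t' ht' h
    by_contra! h'
    obtain ⟨x, hx, hx0⟩ := isPreconnected_Ici.intermediate_value (mem_Ici.2 ht) (mem_Ici.2 ht')
      hcont ⟨h.le, h'⟩
    exact hu0 x hx hx0
  refine ⟨s, le_rfl, ?_⟩
  rcases (hu0 s le_rfl).lt_or_gt with h | h
  · have hall : ∀ t, s ≤ t → u t < 0 := fun t ht => hconst s le_rfl t ht h
    exact ⟨.inl fun t ht => (hall t ht).le, .inr fun t ht => (hneg t ht (hall t ht).le).le⟩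
  · have hall : ∀ t, s ≤ t → 0 ≤ u t := fun t ht =>
      not_lt.1 fun h' => lt_asymm h (hconst t ht s le_rfl h')
    exact ⟨.inr hall, .inl fun t ht => (hpos t ht (hall t ht)).le⟩

/-- A trajectory staying in a compact set on which a strict Lyapunov function exists converges to
the minimum of that function. -/
theorem tendsto_of_strict_lyapunov {X : Type*} [MetricSpace X] {K : Set X} (hK : IsCompact K)
    {V D : X → ℝ} {e : X} (hV : ContinuousOn V K) (hD : ContinuousOn D K) (hVe : V e = 0)
    (hDe : 0 ≤ D e) (hVpos : ∀ x ∈ K, x ≠ e → 0 < V x) (hDpos : ∀ x ∈ K, x ≠ e → 0 < D x)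
    {x : ℝ → X} {s : ℝ} (hx : ∀ t, s ≤ t → x t ∈ K)
    (hderiv : ∀ t, s ≤ t → HasDerivAt (fun t => V (x t)) (-D (x t)) t) :
    Tendsto x atTop (nhds e) := by
  have lower : ∀ (f : X → ℝ) (S : Set X), IsCompact S → ContinuousOn f S →
      (∀ y ∈ S, 0 < f y) → ∃ m > 0, ∀ y ∈ S, m ≤ f y := by
    intro f S hS hf hpos
    rcases S.eq_empty_or_nonempty with rfl | hne
    · exact ⟨1, one_pos, by simp⟩
    · obtain ⟨y, hy, hmin⟩ := hS.exists_isMinOn hne hf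
      exact ⟨f y, hpos y hy, fun z hz => hmin hz⟩
  have hDnn : ∀ y ∈ K, 0 ≤ D y := fun y hy => by
    by_cases h : y = e
    · rwa [h]
    · exact (hDpos y hy h).le
  have hanti : AntitoneOn (fun t => V (x t)) (Ici s) :=
    antitoneOn_Ici_of_hasDerivAt_nonpos hderiv fun t ht => neg_nonpos.2 (hDnn _ (hx t ht))
  rw [Metric.tendsto_atTop]
  intro ε hε
  obtain ⟨m, hm, hmV⟩ := lower V (K ∩ {y | ε ≤ dist y e})
    (hK.inter_right (isClosed_le continuous_const (continuous_id.dist continuous_const)))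
    (hV.mono inter_subset_left) fun y hy => hVpos y hy.1 fun h => by
      have := hy.2
      simp only [h, mem_ofPred_eq, dist_self] at this
      linarith
  obtain ⟨δ, hδ, hδD⟩ := lower D (K ∩ V ⁻¹' Ici (m / 2))
    (hK.of_isClosed_subset (hV.preimage_isClosed_of_isClosed hK.isClosed isClosed_Ici)
      inter_subset_left) (hD.mono inter_subset_left) fun y hy => hDpos y hy.1 fun h => by
      have : m / 2 ≤ V y := hy.2
      rw [h, hVe] at this
      linarith
  obtain ⟨t₁, ht₁, h₁⟩ := eventually_ge_of_hasDerivAt_pos_below (f := fun t => -V (x t))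
    (f' := fun t => D (x t)) (l := -(m / 2)) hδ
    (fun t ht => by simpa using (hderiv t ht).fun_neg)
    (fun t ht h => hδD _ ⟨hx t ht, by simpa using h⟩)
  refine ⟨t₁, fun t ht => ?_⟩
  by_contra! hdist
  have := hmV (x t) ⟨hx t (ht₁.trans ht), hdist⟩
  linarith [h₁ t ht]

theorem hasDerivAt_integral_of_continuousOn {U : Set ℝ} (hU : IsOpen U) (hUc : U.OrdConnected)
    {n : ℝ → ℝ} (hn : ContinuousOn n U) {e x : ℝ} (he : e ∈ U) (hx : x ∈ U) :
    HasDerivAt (fun y => ∫ s in e..y, n s) (n x) x := by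
  refine intervalIntegral.integral_hasDerivAt_right
    ((hn.mono (hUc.uIcc_subset he hx)).intervalIntegrable)
    (hn.stronglyMeasurableAtFilter hU x hx) (hn.continuousAt (hU.mem_nhds hx))

theorem integral_pos_of_sign {S : Set ℝ} (hS : S.OrdConnected)
    {n : ℝ → ℝ} (hn : ContinuousOn n S) {e x : ℝ} (he : e ∈ S) (hx : x ∈ S)
    (hpos : ∀ s ∈ S, e < s → 0 < n s) (hneg : ∀ s ∈ S, s < e → n s < 0) (hxe : x ≠ e) :
    0 < ∫ s in e..x, n s := by
  have hint := (hn.mono (hS.uIcc_subset he hx)).intervalIntegrable (μ := MeasureTheory.volume)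
  rcases hxe.lt_or_gt with h | h
  · rw [intervalIntegral.integral_symm, ← intervalIntegral.integral_neg]
    exact intervalIntegral.intervalIntegral_pos_of_pos_on hint.symm.neg
      (fun s hs => neg_pos.2 (hneg s (hS.out hx he ⟨hs.1.le, hs.2.le⟩) hs.2)) h
  · exact intervalIntegral.intervalIntegral_pos_of_pos_on hint
      (fun s hs => hpos s (hS.out he hx ⟨hs.1.le, hs.2.le⟩) hs.1) h

theorem rfun_pos (β a z : ℝ) : 0 < rfun β a z := by unfold rfun; positivity

theorem rfun_le_one (β a z : ℝ) : rfun β a z ≤ 1 := by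
  unfold rfun
  rw [div_le_one (by positivity)]
  linarith [exp_pos (-β * (z - a))]

theorem hasDerivAt_rfun (β a z : ℝ) :
    HasDerivAt (rfun β a)
      (β * exp (-β * (z - a)) / (1 + exp (-β * (z - a))) ^ 2) z := by
  have hlin : HasDerivAt (fun z => -β * (z - a)) (-β) z := by
    simpa using ((hasDerivAt_id z).sub_const a).const_mul (-β)
  have hpos : 1 + exp (-β * (z - a)) ≠ 0 := by positivity
  have h := (hasDerivAt_const z (1 : ℝ)).fun_div (hlin.exp.const_add 1) hpos
  exact h.congr_deriv (by ring)

theorem continuous_rfun (β a : ℝ) : Continuous (rfun β a) :=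
  continuous_iff_continuousAt.2 fun z => (hasDerivAt_rfun β a z).continuousAt

theorem strictMono_rfun {β : ℝ} (hβ : 0 < β) (a : ℝ) : StrictMono (rfun β a) :=
  strictMono_of_hasDerivAt_pos (hasDerivAt_rfun β a) fun z => by positivity

theorem hasDerivAt_hfun (θ p : ℝ) {z : ℝ} (hz : 0 ≤ z) :
    HasDerivAt (hfun θ p) (-(θ * (p * (1 + z) ^ (p - 1)) / ((1 + z) ^ p) ^ 2)) z := by
  have h1 : HasDerivAt (fun z => 1 + z) 1 z := (hasDerivAt_id z).const_add 1
  have h2 := h1.rpow_const (p := p) (.inl (by positivity))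
  exact ((hasDerivAt_const z θ).fun_div h2 (by positivity)).congr_deriv (by ring)

theorem continuousOn_Phi (ω lamb z₀ β a : ℝ) (S : Set (ℝ × ℝ)) :
    ContinuousOn (fun x : ℝ × ℝ => Phi ω lamb z₀ β a x.1 x.2) S := by
  have := continuous_rfun β a
  unfold Phi Gfun
  fun_prop

theorem continuousOn_Psi (θ αb p : ℝ) :
    ContinuousOn (fun x : ℝ × ℝ => Psi θ αb p x.1 x.2) {x | 0 ≤ x.1} := by
  have hh : ContinuousOn (hfun θ p) (Ici 0) := fun z hz =>
    (hasDerivAt_hfun θ p hz).continuousAt.continuousWithinAt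
  unfold Psi
  exact continuousOn_const.sub
    (continuousOn_snd.mul (hh.comp continuousOn_fst fun _ hx => hx))

/-- Convergence when `lamb ≤ z₀`: the system is cooperative along the trajectory. -/
theorem riot_convergence_of_le
    {ω θ z₀ β a p lamb αb M : ℝ} {lam alp : ℝ → ℝ}
    (hω : 0 < ω) (hθ : 0 < θ) (hβ : 0 < β) (hp : 0 < p) (hle : lamb ≤ z₀)
    (hlamode : ∀ t, 0 ≤ t → HasDerivAt lam (Phi ω lamb z₀ β a (lam t) (alp t)) t)
    (halpode : ∀ t, 0 ≤ t → HasDerivAt alp (Psi θ αb p (lam t) (alp t)) t)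
    (hinit : lam 0 ≤ z₀)
    (hregion : ∀ t, 0 ≤ t → 0 ≤ lam t ∧ 0 ≤ alp t)
    (hM : ∀ t, 0 ≤ t → |lam t| ≤ M ∧ |alp t| ≤ M) :
    ∃ le ae : ℝ, Phi ω lamb z₀ β a le ae = 0 ∧ Psi θ αb p le ae = 0 ∧
      Tendsto lam atTop (nhds le) ∧ Tendsto alp atTop (nhds ae) := by
  have hlz : ∀ t, 0 ≤ t → lam t ≤ z₀ := by
    refine le_of_hasDerivAt_nonpos_above hlamode (fun t ht h => ?_) hinit
    have h1 := mul_nonneg (mul_nonneg (rfun_pos β a (alp t)).le (hregion t ht).1)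
      (sub_nonneg.2 h.le)
    have h2 := mul_nonneg hω.le (sub_nonneg.2 (hle.trans h.le))
    unfold Phi Gfun
    linarith
  have hlc : ContinuousOn lam (Ici 0) := fun t ht =>
    (hlamode t ht).continuousAt.continuousWithinAt
  have hac : ContinuousOn alp (Ici 0) := fun t ht =>
    (halpode t ht).continuousAt.continuousWithinAt
  have hpos : ∀ t, 0 ≤ t → 0 < 1 + lam t := fun t ht => by linarith [(hregion t ht).1]
  have hrc := continuous_rfun β a
  have hrpow : ∀ q : ℝ, ContinuousOn (fun t => (1 + lam t) ^ q) (Ici 0) := fun q =>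
    (continuousOn_const.add hlc).rpow_const fun t ht => .inl (hpos t ht).ne'
  obtain ⟨t₀, ht₀, hu, hv⟩ := eventually_sign_of_cooperative
    (u := fun t => Phi ω lamb z₀ β a (lam t) (alp t))
    (v := fun t => Psi θ αb p (lam t) (alp t))
    (a := fun t => -ω + rfun β a (alp t) * (z₀ - 2 * lam t))
    (b := fun t => β * exp (-β * (alp t - a)) / (1 + exp (-β * (alp t - a))) ^ 2
      * Gfun z₀ (lam t))
    (c := fun t => alp t * (θ * (p * (1 + lam t) ^ (p - 1)) / ((1 + lam t) ^ p) ^ 2))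
    (d := fun t => -hfun θ p (lam t)) (s := 0)
    (by fun_prop)
    (by
      unfold Gfun
      refine ContinuousOn.mul (ContinuousOn.div (by fun_prop) (by fun_prop) fun t _ => ?_)
        (by fun_prop)
      positivity)
    (by
      refine hac.mul (ContinuousOn.div ?_ ((hrpow p).pow 2) fun t ht => ?_)
      · exact continuousOn_const.mul (continuousOn_const.mul (hrpow (p - 1)))
      · have := hpos t ht
        positivity)
    (fun t ht => ((hasDerivAt_hfun θ p (hregion t ht).1).continuousAt.comp
      (hlamode t ht).continuousAt).neg.continuousWithinAt)
    (fun t ht => by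
      have h1 := (hregion t ht).1
      have h2 := sub_nonneg.2 (hlz t ht)
      unfold Gfun
      positivity)
    (fun t ht => by
      have h1 := (hregion t ht).2
      have h2 := hpos t ht
      positivity)
    (fun t ht => by
      have hl := hlamode t ht
      have hr := (hasDerivAt_rfun β a (alp t)).comp t (halpode t ht)
      have h := ((hl.sub_const lamb).const_mul (-ω)).fun_add
        (hr.fun_mul (hl.fun_mul (hl.const_sub z₀)))
      refine h.congr_deriv ?_
      simp only [Gfun, Function.comp_apply]
      ring)
    (fun t ht => by
      have hh := (hasDerivAt_hfun θ p (hregion t ht).1).comp t (hlamode t ht)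
      have h := ((halpode t ht).fun_mul hh).const_sub (θ * αb)
      refine h.congr_deriv ?_
      simp only [Function.comp_apply]
      ring)
  obtain ⟨le, hle⟩ : ∃ l, Tendsto lam atTop (nhds l) := by
    rcases hu with hu | hu
    · exact exists_tendsto_of_hasDerivAt_nonpos (fun t ht => hlamode t (ht₀.trans ht)) hu
        fun t ht => (hM t (ht₀.trans ht)).1
    · exact exists_tendsto_of_hasDerivAt_nonneg (fun t ht => hlamode t (ht₀.trans ht)) hu
        fun t ht => (hM t (ht₀.trans ht)).1
  obtain ⟨ae, hae⟩ : ∃ l, Tendsto alp atTop (nhds l) := by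
    rcases hv with hv | hv
    · exact exists_tendsto_of_hasDerivAt_nonpos (fun t ht => halpode t (ht₀.trans ht)) hv
        fun t ht => (hM t (ht₀.trans ht)).2
    · exact exists_tendsto_of_hasDerivAt_nonneg (fun t ht => halpode t (ht₀.trans ht)) hv
        fun t ht => (hM t (ht₀.trans ht)).2
  have hge : 0 ≤ le := ge_of_tendsto hle <| by
    filter_upwards [eventually_ge_atTop 0] with t ht using (hregion t ht).1
  have hpair : Tendsto (fun t => (lam t, alp t)) atTop (nhdsWithin (le, ae) {x | 0 ≤ x.1}) := by
    refine tendsto_nhdsWithin_iff.2 ⟨hle.prodMk_nhds hae, ?_⟩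
    filter_upwards [eventually_ge_atTop 0] with t ht using (hregion t ht).1
  exact ⟨le, ae,
    eq_zero_of_tendsto_of_tendsto_deriv hlamode hle
      ((continuousOn_Phi ω lamb z₀ β a _ (le, ae) hge).tendsto.comp hpair),
    eq_zero_of_tendsto_of_tendsto_deriv halpode hae
      ((continuousOn_Psi θ αb p (le, ae) hge).tendsto.comp hpair), hle, hae⟩

theorem exists_rfun_weight {β : ℝ} (hβ : 0 < β) (a : ℝ) {c e : ℝ}
    (hc : 0 < c ∨ c = 0 ∧ e = 0) :
    ∃ (n : ℝ → ℝ) (U : Set ℝ), IsOpen U ∧ U.OrdConnected ∧ Ici c ⊆ U ∧ ContinuousOn n U ∧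
      (∀ A, c ≤ A → n A * A = rfun β a A - rfun β a e) ∧
      (∀ A ∈ Ici c, e < A → 0 < n A) ∧ (∀ A ∈ Ici c, A < e → n A < 0) := by
  have hmono := strictMono_rfun hβ a
  rcases hc with hc | ⟨rfl, rfl⟩
  · refine ⟨fun A => (rfun β a A - rfun β a e) / A, Ioi 0, isOpen_Ioi, ordConnected_Ioi,
      fun x hx => hc.trans_le hx, ?_, fun A hA => ?_, fun A hA h => ?_, fun A hA h => ?_⟩
    · exact ((continuous_rfun β a).continuousOn.sub continuousOn_const).div continuousOn_id
        fun A hA => ne_of_gt hA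
    · exact div_mul_cancel₀ _ (hc.trans_le hA).ne'
    · exact div_pos (sub_pos.2 (hmono h)) (hc.trans_le hA)
    · exact div_neg_of_neg_of_pos (sub_neg.2 (hmono h)) (hc.trans_le hA)
  · refine ⟨dslope (rfun β a) 0, univ, isOpen_univ, ordConnected_univ, subset_univ _, ?_,
      fun A _ => ?_, fun A _ h => ?_, fun A hA h => absurd h (not_lt.2 hA)⟩
    · exact (continuousOn_dslope univ_mem).2
        ⟨(continuous_rfun β a).continuousOn, (hasDerivAt_rfun β a 0).differentiableAt⟩
    · simpa [mul_comm] using sub_smul_dslope (rfun β a) 0 A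
    · rw [dslope_of_ne _ h.ne', slope_def_field]
      exact div_pos (sub_pos.2 (hmono h)) (sub_pos.2 h)

/-- Convergence when `z₀ < lamb`: the trajectory enters a region carrying a strict Lyapunov
function. -/
theorem riot_convergence_of_lt
    {ω θ z₀ β a p lamb αb M : ℝ} {lam alp : ℝ → ℝ}
    (hω : 0 < ω) (hθ : 0 < θ) (hz₀ : 0 < z₀) (hβ : 0 < β) (hp : 0 < p) (hαb : 0 ≤ αb)
    (hlt : z₀ < lamb)
    (hlamode : ∀ t, 0 ≤ t → HasDerivAt lam (Phi ω lamb z₀ β a (lam t) (alp t)) t)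
    (halpode : ∀ t, 0 ≤ t → HasDerivAt alp (Psi θ αb p (lam t) (alp t)) t)
    (hregion : ∀ t, 0 ≤ t → 0 ≤ lam t ∧ 0 ≤ alp t)
    (hM : ∀ t, 0 ≤ t → |lam t| ≤ M ∧ |alp t| ≤ M) :
    ∃ le ae : ℝ, Phi ω lamb z₀ β a le ae = 0 ∧ Psi θ αb p le ae = 0 ∧
      Tendsto lam atTop (nhds le) ∧ Tendsto alp atTop (nhds ae) := by
  have hrpos := rfun_pos β a
  have hpow : ∀ l : ℝ, 0 ≤ l → 1 ≤ (1 + l) ^ p := fun l hl => one_le_rpow (by linarith) hp.le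
  -- the equilibrium
  obtain ⟨le, ⟨hle1, hle2⟩, hleq⟩ : ∃ le ∈ Icc z₀ lamb,
      Phi ω lamb z₀ β a le (αb * (1 + le) ^ p) = 0 := by
    have hcont : ContinuousOn (fun l => Phi ω lamb z₀ β a l (αb * (1 + l) ^ p))
        (Icc z₀ lamb) := by
      refine (continuousOn_Phi ω lamb z₀ β a univ).comp (continuousOn_id.prodMk ?_)
        (mapsTo_univ _ _)
      exact continuousOn_const.mul ((continuousOn_const.add continuousOn_id).rpow_const
        fun l hl => .inl (show 1 + l ≠ 0 by linarith [hl.1]))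
    refine intermediate_value_Icc' hlt.le hcont ⟨?_, ?_⟩
    · have := mul_nonneg (hrpos (αb * (1 + lamb) ^ p)).le
        (mul_nonneg (hz₀.trans hlt).le (sub_nonneg.2 hlt.le))
      simp only [Phi, Gfun]
      linarith
    · have := mul_nonneg hω.le (sub_nonneg.2 hlt.le)
      simp only [Phi, Gfun]
      linarith
  have hzle : z₀ < le := by
    refine lt_of_le_of_ne hle1 fun h => ?_
    have h2 := mul_pos hω (sub_pos.2 hlt)
    rw [← h] at hleq
    simp only [Phi, Gfun] at hleq
    linarith
  set ae := αb * (1 + le) ^ p with hae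
  have hle0 : 0 < le := hz₀.trans hzle
  have hpe : 0 < (1 + le) ^ p := by positivity
  have hpsi : Psi θ αb p le ae = 0 := by
    simp only [Psi, hfun, hae]
    field_simp
    ring
  -- the trajectory enters a compact set
  obtain ⟨l₁, hl₁, hl₁c⟩ : ∃ l₁, z₀ < l₁ ∧
      ∀ l A, 0 ≤ l → l ≤ l₁ → ω * (lamb - z₀) / 2 ≤ Phi ω lamb z₀ β a l A := by
    have hg := mul_pos hω (sub_pos.2 hlt)
    have hden : 0 < ω + lamb := by linarith
    set ε := min (lamb - z₀) (ω * (lamb - z₀) / 2 / (ω + lamb)) with hε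
    have hε0 : 0 < ε := lt_min (by linarith) (by positivity)
    have hε1 : ε ≤ lamb - z₀ := min_le_left _ _
    have hε2 : ε * (ω + lamb) ≤ ω * (lamb - z₀) / 2 := by
      rw [← le_div_iff₀ hden]
      exact min_le_right _ _
    refine ⟨z₀ + ε, by linarith, fun l A hl0 hl => ?_⟩
    have hr0 := hrpos A
    have hr1 := rfun_le_one β a A
    have hG : -(lamb * ε) ≤ rfun β a A * Gfun z₀ l := by
      unfold Gfun
      rcases le_total l z₀ with h | h
      · have h1 := mul_nonneg hr0.le (mul_nonneg hl0 (sub_nonneg.2 h))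
        have h2 : 0 < lamb * ε := mul_pos (by linarith) hε0
        linarith
      · have h1 : l * (l - z₀) ≤ lamb * ε :=
          mul_le_mul (by linarith) (by linarith) (by linarith) (by linarith)
        have h2 := mul_le_mul_of_nonneg_right hr1 (mul_nonneg hl0 (sub_nonneg.2 h))
        linarith
    have hlin := mul_le_mul_of_nonneg_left hl hω.le
    unfold Phi
    linarith
  obtain ⟨t₁, ht₁, hlam⟩ := eventually_ge_of_hasDerivAt_pos_below (l := l₁)
    (by have := mul_pos hω (sub_pos.2 hlt); linarith : 0 < ω * (lamb - z₀) / 2) hlamode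
    (fun t ht h => hl₁c _ _ (hregion t ht).1 h)
  obtain ⟨t₂, ht₂, halp⟩ : ∃ t₂, 0 ≤ t₂ ∧ ∀ t, t₂ ≤ t → αb / 2 ≤ alp t := by
    rcases hαb.eq_or_lt with h | h
    · exact ⟨0, le_rfl, fun t ht => by simpa [← h] using (hregion t ht).2⟩
    · refine eventually_ge_of_hasDerivAt_pos_below (c := θ * αb / 2) (by positivity) halpode
        fun t ht hA => ?_
      have h1 : alp t * hfun θ p (lam t) ≤ αb / 2 * θ :=
        mul_le_mul hA (div_le_self hθ.le (hpow _ (hregion t ht).1))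
          (div_nonneg hθ.le (zero_le_one.trans (hpow _ (hregion t ht).1))) (by positivity)
      unfold Psi
      linarith
  have haele : αb ≤ ae := le_mul_of_one_le_right hαb (hpow le hle0.le)
  obtain ⟨n, U, hU, hUc, hcU, hn, hnr, hnpos, hnneg⟩ :=
    exists_rfun_weight hβ a (c := αb / 2) (e := ae) (by
      rcases hαb.eq_or_lt with h | h
      · exact .inr ⟨by simp [← h], by simp [hae, ← h]⟩
      · exact .inl (by positivity))
  have haeS : ae ∈ Ici (αb / 2) := mem_Ici.2 (by linarith)
  -- the weight in the first variable
  set q : ℝ → ℝ := fun s => hfun θ p le - hfun θ p s with hq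
  have hhanti : ∀ x y, 0 ≤ x → x < y → hfun θ p y < hfun θ p x := fun x y hx hxy =>
    div_lt_div_of_pos_left hθ (by positivity)
      (rpow_lt_rpow (by linarith) (by linarith) hp)
  have hgpos : ∀ s, z₀ < s → 0 < s * (s - z₀) := fun s hs =>
    mul_pos (hz₀.trans hs) (sub_pos.2 hs)
  set m : ℝ → ℝ := fun s => q s / (s * (s - z₀)) with hm
  have hmc : ContinuousOn m (Ioi z₀) := by
    refine ContinuousOn.div (continuousOn_const.sub fun s hs => ?_) (by fun_prop)
      fun s hs => (hgpos s hs).ne'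
    exact (hasDerivAt_hfun θ p (hz₀.trans hs).le).continuousAt.continuousWithinAt
  have hmpos : ∀ s ∈ Ioi z₀, le < s → 0 < m s := fun s hs h =>
    div_pos (sub_pos.2 (hhanti le s hle0.le h)) (hgpos s hs)
  have hmneg : ∀ s ∈ Ioi z₀, s < le → m s < 0 := fun s hs h =>
    div_neg_of_neg_of_pos (sub_neg.2 (hhanti s le (hz₀.trans hs).le h)) (hgpos s hs)
  have hV1 : ∀ x ∈ Ioi z₀, HasDerivAt (fun y => ∫ s in le..y, m s) (m x) x := fun x hx =>
    hasDerivAt_integral_of_continuousOn isOpen_Ioi ordConnected_Ioi hmc hzle hx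
  have hV2 : ∀ x ∈ Ici (αb / 2), HasDerivAt (fun y => ∫ s in ae..y, n s) (n x) x := fun x hx =>
    hasDerivAt_integral_of_continuousOn hU hUc hn (hcU haeS) (hcU hx)
  have hV1pos : ∀ x ∈ Ioi z₀, x ≠ le → 0 < ∫ s in le..x, m s := fun x hx =>
    integral_pos_of_sign ordConnected_Ioi hmc hzle hx hmpos hmneg
  have hV2pos : ∀ x ∈ Ici (αb / 2), x ≠ ae → 0 < ∫ s in ae..x, n s := fun x hx =>
    integral_pos_of_sign ordConnected_Ici (hn.mono hcU) haeS hx hnpos hnneg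
  set E : ℝ → ℝ := fun l => ω * (lamb - l) - rfun β a ae * (l * (l - z₀)) with hE
  have hEle : E le = 0 := by
    simp only [Phi, Gfun] at hleq
    simp only [hE]
    linarith
  have hEanti : ∀ x y, z₀ < x → x < y → E y < E x := fun x y hx hxy => by
    have h1 : x * (x - z₀) < y * (y - z₀) :=
      mul_lt_mul'' hxy (by linarith) (by linarith) (by linarith)
    have h2 := mul_lt_mul_of_pos_left h1 (hrpos ae)
    have h3 := mul_lt_mul_of_pos_left hxy hω
    simp only [hE]
    linarith
  have hdiss : ∀ l A, z₀ < l → αb / 2 ≤ A →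
      -(m l * Phi ω lamb z₀ β a l A + n A * Psi θ αb p l A)
        = m l * (0 - E l) + n A * (A - ae) * hfun θ p le := by
    intro l A hl hA
    have h1 : m l * (l * (l - z₀)) = hfun θ p le - hfun θ p l :=
      div_mul_cancel₀ _ (hgpos l hl).ne'
    have h2 := hnr A hA
    have h3 : ae * hfun θ p le = θ * αb := by
      unfold Psi at hpsi
      linarith
    simp only [hE, Phi, Psi, Gfun]
    linear_combination (rfun β a A - rfun β a ae) * h1
      + (hfun θ p l - hfun θ p le) * h2 + n A * h3
  have hh0 : 0 < hfun θ p le := div_pos hθ hpe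
  have hD1 : ∀ l, z₀ < l → l ≠ le → 0 < m l * (0 - E l) := fun l hl hne => by
    rcases hne.lt_or_gt with h | h
    · exact mul_pos_of_neg_of_neg (hmneg l hl h) (by linarith [hEanti l le hl h])
    · exact mul_pos (hmpos l hl h) (by linarith [hEanti le l hzle h])
  have hD2 : ∀ A, αb / 2 ≤ A → A ≠ ae → 0 < n A * (A - ae) * hfun θ p le := fun A hA hne => by
    refine mul_pos ?_ hh0
    rcases hne.lt_or_gt with h | h
    · exact mul_pos_of_neg_of_neg (hnneg A hA h) (sub_neg.2 h)
    · exact mul_pos (hnpos A hA h) (sub_pos.2 h)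
  have hpos_add : ∀ {f g : ℝ → ℝ} {S T : Set ℝ} {x₀ y₀ : ℝ}, f x₀ = 0 → g y₀ = 0 →
      (∀ x ∈ S, x ≠ x₀ → 0 < f x) → (∀ y ∈ T, y ≠ y₀ → 0 < g y) →
      ∀ z ∈ S ×ˢ T, z ≠ (x₀, y₀) → 0 < f z.1 + g z.2 := by
    rintro f g S T x₀ y₀ hf0 hg0 hf hg ⟨x, y⟩ ⟨hx, hy⟩ hne
    by_cases h : x = x₀
    · have hy' : y ≠ y₀ := fun h' => hne (by rw [h, h'])
      simpa [h, hf0] using hg y hy hy'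
    · by_cases h' : y = y₀
      · simpa [h', hg0] using hf x hx h
      · exact add_pos (hf x hx h) (hg y hy h')
  have hsub : Icc l₁ M ×ˢ Icc (αb / 2) M ⊆ Ioi z₀ ×ˢ Ici (αb / 2) :=
    prod_mono (fun x hx => hl₁.trans_le hx.1) fun x hx => hx.1
  have hpsic : ContinuousOn (fun x : ℝ × ℝ => Psi θ αb p x.1 x.2) (Ioi z₀ ×ˢ Ici (αb / 2)) :=
    (continuousOn_Psi θ αb p).mono fun x hx => (hz₀.trans hx.1).le
  have htend : Tendsto (fun t => (lam t, alp t)) atTop (nhds (le, ae)) := by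
    refine tendsto_of_strict_lyapunov (K := Icc l₁ M ×ˢ Icc (αb / 2) M)
      (V := fun x => (∫ s in le..x.1, m s) + ∫ s in ae..x.2, n s)
      (D := fun x => -(m x.1 * Phi ω lamb z₀ β a x.1 x.2 + n x.2 * Psi θ αb p x.1 x.2))
      (s := max t₁ t₂) (isCompact_Icc.prod isCompact_Icc) ?_ ?_ ?_ ?_ ?_ ?_ ?_ ?_
    · refine ContinuousOn.mono (ContinuousOn.add ?_ ?_) hsub
      · exact ContinuousOn.comp (t := Ioi z₀)
          (fun x hx => (hV1 x hx).continuousAt.continuousWithinAt) continuousOn_fst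
          fun x hx => hx.1
      · exact ContinuousOn.comp (t := Ici (αb / 2))
          (fun x hx => (hV2 x hx).continuousAt.continuousWithinAt) continuousOn_snd
          fun x hx => hx.2
    · refine ContinuousOn.mono (ContinuousOn.neg (ContinuousOn.add ?_ ?_)) hsub
      · exact (hmc.comp continuousOn_fst fun x hx => hx.1).mul (continuousOn_Phi ω lamb z₀ β a _)
      · exact ((hn.mono hcU).comp continuousOn_snd fun x hx => hx.2).mul hpsic
    · simp
    · simp [hleq, hpsi]
    · exact fun x hx => hpos_add (f := fun y => ∫ s in le..y, m s)
        (g := fun y => ∫ s in ae..y, n s) (by simp) (by simp) hV1pos hV2pos x (hsub hx)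
    · intro x hx hne
      have hx' := hsub hx
      simp only [hdiss x.1 x.2 hx'.1 hx'.2]
      exact hpos_add (f := fun l => m l * (0 - E l))
        (g := fun A => n A * (A - ae) * hfun θ p le) (by simp [hEle]) (by simp) hD1 hD2
        x hx' hne
    · intro t ht
      have h1 : t₁ ≤ t := (le_max_left _ _).trans ht
      have h2 : t₂ ≤ t := (le_max_right _ _).trans ht
      have h3 := hM t (ht₁.trans h1)
      exact ⟨⟨hlam t h1, (abs_le.1 h3.1).2⟩, ⟨halp t h2, (abs_le.1 h3.2).2⟩⟩
    · intro t ht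
      have h1 : t₁ ≤ t := (le_max_left _ _).trans ht
      have h2 : t₂ ≤ t := (le_max_right _ _).trans ht
      rw [neg_neg]
      exact ((hV1 (lam t) (hl₁.trans_le (hlam t h1))).comp t (hlamode t (ht₁.trans h1))).add
        ((hV2 (alp t) (halp t h2)).comp t (halpode t (ht₁.trans h1)))
  exact ⟨le, ae, hleq, hpsi, (continuous_fst.tendsto _).comp htend,
    (continuous_snd.tendsto _).comp htend⟩

theorem eq_of_tendsto_of_add_period {f : ℝ → ℝ} {P l : ℝ} (hP : 0 < P)
    (hf : ∀ t, 0 ≤ t → f (t + P) = f t) (hl : Tendsto f atTop (nhds l)) :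
    ∀ t, 0 ≤ t → f t = l := by
  intro t ht
  have hn : ∀ n : ℕ, f (t + n * P) = f t := by
    intro n
    induction n with
    | zero => simp
    | succ k ih =>
      rw [← ih, ← hf (t + k * P) (by positivity)]
      push_cast
      ring_nf
  have htend : Tendsto (fun n : ℕ => t + n * P) atTop atTop :=
    tendsto_atTop_add_const_left _ _ (tendsto_natCast_atTop_atTop.atTop_mul_const hP)
  exact tendsto_nhds_unique (tendsto_const_nhds.congr fun n => (hn n).symm) (hl.comp htend)

theorem exists_bound_of_add_period {f : ℝ → ℝ} {P : ℝ} (hP : 0 < P)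
    (hf : ∀ t, 0 ≤ t → f (t + P) = f t) (hc : ContinuousOn f (Ici 0)) :
    ∃ M, ∀ t, 0 ≤ t → |f t| ≤ M := by
  obtain ⟨M, hM⟩ := isCompact_Icc.exists_bound_of_continuousOn
    (hc.mono (Icc_subset_Ici_self : Icc 0 P ⊆ Ici 0))
  have hn : ∀ (n : ℕ) t, 0 ≤ t → t ≤ n * P → |f t| ≤ M := by
    intro n
    induction n with
    | zero =>
      intro t ht h
      exact hM t ⟨ht, by simp at h; linarith⟩
    | succ k ih =>
      intro t ht h
      rcases le_total t P with h' | h'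
      · exact hM t ⟨ht, h'⟩
      · have h2 := hf (t - P) (by linarith)
        rw [sub_add_cancel] at h2
        rw [h2]
        push_cast at h
        exact ih (t - P) (by linarith) (by linarith)
  refine ⟨M, fun t ht => ?_⟩
  obtain ⟨n, hnt⟩ := exists_nat_ge (t / P)
  exact hn n t ht ((div_le_iff₀ hP).1 hnt)

/-- no cycles / convergence to equilibrium for the planar single-site
system (Poincaré–Bendixson argument): there are no nonconstant periodic orbits,
and every bounded forward trajectory converges to a stationary point. -/
theorem riot_no_cycles_convergence
    (ω θ z₀ β a p lamb αb : ℝ) (lam alp : ℝ → ℝ)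
    (hω : 0 < ω) (hθ : 0 < θ) (hz₀ : 0 < z₀) (hβ : 0 < β)
    (hp : 0 < p) (hp1 : p ≤ 1) (hαb : 0 ≤ αb) (hlamb : 0 ≤ lamb)
    (hlamode : ∀ t, 0 ≤ t →
      HasDerivAt lam (Phi ω lamb z₀ β a (lam t) (alp t)) t)
    (halpode : ∀ t, 0 ≤ t →
      HasDerivAt alp (Psi θ αb p (lam t) (alp t)) t)
    (hinit : 0 ≤ lam 0 ∧ lam 0 ≤ z₀ ∧ 0 ≤ alp 0)
    (hregion : ∀ t, 0 ≤ t → 0 ≤ lam t ∧ 0 ≤ alp t) :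
    (∀ P > (0:ℝ), (∀ t, 0 ≤ t → lam (t + P) = lam t ∧ alp (t + P) = alp t) →
      ∀ t, 0 ≤ t → lam t = lam 0 ∧ alp t = alp 0) ∧
    ((∃ M : ℝ, ∀ t, 0 ≤ t → |lam t| ≤ M ∧ |alp t| ≤ M) →
      ∃ le ae : ℝ, Phi ω lamb z₀ β a le ae = 0 ∧ Psi θ αb p le ae = 0 ∧
        Tendsto lam atTop (nhds le) ∧ Tendsto alp atTop (nhds ae)) := by
  have hconv : (∃ M : ℝ, ∀ t, 0 ≤ t → |lam t| ≤ M ∧ |alp t| ≤ M) →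
      ∃ le ae : ℝ, Phi ω lamb z₀ β a le ae = 0 ∧ Psi θ αb p le ae = 0 ∧
        Tendsto lam atTop (nhds le) ∧ Tendsto alp atTop (nhds ae) := by
    rintro ⟨M, hM⟩
    rcases le_or_gt lamb z₀ with h | h
    · exact riot_convergence_of_le hω hθ hβ hp h hlamode halpode hinit.2.1 hregion hM
    · exact riot_convergence_of_lt hω hθ hz₀ hβ hp hαb h hlamode halpode hregion hM
  refine ⟨fun P hP hper => ?_, hconv⟩
  obtain ⟨M₁, hM₁⟩ := exists_bound_of_add_period hP (fun t ht => (hper t ht).1)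
    fun t ht => (hlamode t ht).continuousAt.continuousWithinAt
  obtain ⟨M₂, hM₂⟩ := exists_bound_of_add_period hP (fun t ht => (hper t ht).2)
    fun t ht => (halpode t ht).continuousAt.continuousWithinAt
  obtain ⟨le, ae, -, -, hl, ha⟩ := hconv ⟨max M₁ M₂, fun t ht =>
    ⟨(hM₁ t ht).trans (le_max_left _ _), (hM₂ t ht).trans (le_max_right _ _)⟩⟩
  have h1 := eq_of_tendsto_of_add_period hP (fun t ht => (hper t ht).1) hl
  have h2 := eq_of_tendsto_of_add_period hP (fun t ht => (hper t ht).2) ha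
  exact fun t ht => ⟨(h1 t ht).trans (h1 0 le_rfl).symm, (h2 t ht).trans (h2 0 le_rfl).symm⟩
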